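/- ∑_{n≥1} 8^n / (n² · 3^n · binom(3n, n)) = π²/6 − (log 3)²/2. -/

import Mathlib

open Filter Topology Set

/-- The continuous extension of `t ↦ -log (1 - t) / t` to `t = 0`. -/
noncomputable def dilogKernel : ℝ → ℝ := dslope (fun t => -Real.log (1 - t)) 0

/-- The real dilogarithm on `(-∞, 1)`. -/
noncomputable def dilog (x : ℝ) : ℝ := ∫ t in (0 : ℝ)..x, dilogKernel t

theorem dilogKernel_of_ne {t : ℝ} (ht : t ≠ 0) : dilogKernel t = -Real.log (1 - t) / t := by
  rw [dilogKernel, dslope_of_ne _ ht, slope_def_field]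
  simp

theorem hasDerivAt_neg_log_one_sub {x : ℝ} (hx : x < 1) :
    HasDerivAt (fun t => -Real.log (1 - t)) (1 - x)⁻¹ x := by
  refine (((hasDerivAt_id x).const_sub 1).log (sub_pos.2 hx).ne').neg.congr_deriv ?_
  simp [neg_div]

theorem dilogKernel_zero : dilogKernel 0 = 1 := by
  rw [dilogKernel, dslope_same, (hasDerivAt_neg_log_one_sub zero_lt_one).deriv]
  simp

theorem continuousOn_dilogKernel : ContinuousOn dilogKernel (Iio 1) := by
  rw [dilogKernel, continuousOn_dslope (Iio_mem_nhds zero_lt_one)]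
  exact ⟨fun x hx => (hasDerivAt_neg_log_one_sub hx).continuousAt.continuousWithinAt,
    (hasDerivAt_neg_log_one_sub zero_lt_one).differentiableAt⟩

theorem hasDerivAt_dilog {x : ℝ} (hx : x < 1) : HasDerivAt dilog (dilogKernel x) x := by
  have hsub : uIcc 0 x ⊆ Iio 1 := fun y hy => (hy.2.trans_lt (max_lt zero_lt_one hx) : y < 1)
  exact intervalIntegral.integral_hasDerivAt_right
    (continuousOn_dilogKernel.mono hsub).intervalIntegrable
    (continuousOn_dilogKernel.stronglyMeasurableAtFilter isOpen_Iio x hx)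
    (continuousOn_dilogKernel.continuousAt (Iio_mem_nhds hx))

theorem dilog_zero : dilog 0 = 0 := intervalIntegral.integral_same

theorem eq_of_hasDerivAt_zero_of_mem {s : Set ℝ} (hs : IsOpen s) (hs' : IsPreconnected s)
    {f : ℝ → ℝ} (hf : ∀ x ∈ s, HasDerivAt f 0 x) {x y : ℝ} (hx : x ∈ s) (hy : y ∈ s) :
    f x = f y :=
  hs.is_const_of_deriv_eq_zero hs' (fun z hz => (hf z hz).differentiableAt.differentiableWithinAt)
    (fun z hz => (hf z hz).deriv) hx hy

theorem hasSum_dilogKernel {t : ℝ} (ht0 : t ≠ 0) (ht : |t| < 1) :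
    HasSum (fun n : ℕ => t ^ n / (n + 1)) (dilogKernel t) := by
  rw [dilogKernel_of_ne ht0]
  convert! (Real.hasSum_pow_div_log_of_abs_lt_one ht).div_const t using 2 with n
  rw [pow_succ]
  field_simp

theorem hasSum_dilog {x : ℝ} (hx0 : 0 ≤ x) (hx : x < 1) :
    HasSum (fun n : ℕ => x ^ (n + 1) / (n + 1 : ℝ) ^ 2) (dilog x) := by
  have h : HasSum (fun n : ℕ => ∫ t in (0 : ℝ)..x, t ^ n / ((n : ℝ) + 1)) (dilog x) := by
    refine intervalIntegral.hasSum_integral_of_dominated_convergence (fun n _ => x ^ n)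
      (fun n => by fun_prop) (fun n => ?_) ?_ (by simp) ?_
    · refine Eventually.of_forall fun t ht => ?_
      rw [uIoc_of_le hx0] at ht
      have h0 := ht.1.le
      rw [Real.norm_of_nonneg (by positivity)]
      refine (div_le_self (by positivity) (by linarith [n.cast_nonneg (α := ℝ)])).trans ?_
      exact pow_le_pow_left₀ h0 ht.2 n
    · exact Eventually.of_forall fun t _ => summable_geometric_of_lt_one hx0 hx
    · refine Eventually.of_forall fun t ht => ?_
      rw [uIoc_of_le hx0] at ht
      exact hasSum_dilogKernel ht.1.ne' (abs_lt.2 ⟨by linarith [ht.1], ht.2.trans_lt hx⟩)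
  convert h using 2 with n
  rw [intervalIntegral.integral_div, integral_pow]
  simp
  field_simp

theorem tendsto_dilog_one : Tendsto dilog (𝓝[<] 1) (𝓝 (Real.pi ^ 2 / 6)) := by
  have hz : HasSum (fun n : ℕ => 1 / (n + 1 : ℝ) ^ 2) (Real.pi ^ 2 / 6) := by
    have := (hasSum_nat_add_iff' 1).2 hasSum_zeta_two
    simpa using this
  rw [← hz.tsum_eq]
  have hI : Ioo (0 : ℝ) 1 ∈ 𝓝[<] (1 : ℝ) := Ioo_mem_nhdsLT zero_lt_one
  have h : Tendsto (fun x : ℝ => ∑' n : ℕ, x ^ (n + 1) / (n + 1 : ℝ) ^ 2) (𝓝[<] 1)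
      (𝓝 (∑' n : ℕ, 1 / (n + 1 : ℝ) ^ 2)) := by
    refine tendsto_tsum_of_dominated_convergence hz.summable (fun n => ?_) ?_
    · have : Continuous fun x : ℝ => x ^ (n + 1) / (n + 1 : ℝ) ^ 2 := by fun_prop
      simpa using (this.tendsto 1).mono_left nhdsWithin_le_nhds
    · filter_upwards [hI] with x hx n
      have := hx.1.le
      rw [Real.norm_of_nonneg (by positivity)]
      gcongr
      exact pow_le_one₀ this hx.2.le
  refine h.congr' ?_
  filter_upwards [hI] with x hx
  exact (hasSum_dilog hx.1.le hx.2).tsum_eq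

/-- Landen's identity. -/
theorem dilog_landen {x : ℝ} (hx : x < 1) :
    dilog x + dilog (x / (x - 1)) = -(Real.log (1 - x) ^ 2 / 2) := by
  have key : ∀ y ∈ Iio (1 : ℝ), HasDerivAt
      (fun x => dilog x + dilog (x / (x - 1)) + Real.log (1 - x) ^ 2 / 2) 0 y := by
    intro y (hy : y < 1)
    have hy1 : y - 1 ≠ 0 := by linarith
    have hy2 : 1 - y ≠ 0 := by linarith
    have hlt : y / (y - 1) < 1 := by
      rw [div_lt_one_of_neg (by linarith)]; linarith
    have h1 : HasDerivAt (fun x : ℝ => x / (x - 1)) (-1 / (y - 1) ^ 2) y := by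
      refine ((hasDerivAt_id y).div ((hasDerivAt_id y).sub_const 1) hy1).congr_deriv ?_
      simp
    have h2 := (hasDerivAt_dilog hlt).comp y h1
    have h3 := ((hasDerivAt_neg_log_one_sub hy).pow 2).div_const 2
    have h := ((hasDerivAt_dilog hy).add h2).add h3
    simp only [Pi.pow_def, neg_sq] at h
    refine h.congr_deriv ?_
    rcases eq_or_ne y 0 with rfl | h0
    · simp [dilogKernel_zero]
    · rw [dilogKernel_of_ne h0, dilogKernel_of_ne (div_ne_zero h0 hy1),
        show 1 - y / (y - 1) = (1 - y)⁻¹ by grind, Real.log_inv]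
      field_simp
      grind
  have := eq_of_hasDerivAt_zero_of_mem isOpen_Iio isPreconnected_Iio key hx
    (show (0 : ℝ) ∈ Iio 1 by simp)
  simp [dilog_zero] at this
  linarith

theorem log_mul_log_one_sub_eq (x : ℝ) :
    Real.log x * Real.log (1 - x) = -(x * Real.log x * dilogKernel x) := by
  rcases eq_or_ne x 0 with rfl | h0
  · simp
  · rw [dilogKernel_of_ne h0]
    field_simp

theorem continuousAt_dilog {x : ℝ} (hx : x < 1) : ContinuousAt dilog x :=
  (hasDerivAt_dilog hx).continuousAt

theorem tendsto_log_mul_log_one_sub :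
    Tendsto (fun x => Real.log x * Real.log (1 - x)) (𝓝 0) (𝓝 0) := by
  simp_rw [log_mul_log_one_sub_eq]
  have := ((Real.continuous_mul_log.tendsto 0).mul
    (continuousOn_dilogKernel.continuousAt (Iio_mem_nhds zero_lt_one))).neg
  simpa using this

theorem tendsto_log_mul_log_one_add :
    Tendsto (fun x => Real.log x * Real.log (1 + x)) (𝓝 0) (𝓝 0) := by
  have h : Tendsto (fun x : ℝ => -x) (𝓝 0) (𝓝 0) := by simpa using (continuous_neg.tendsto (0 : ℝ))
  simpa [Function.comp_def] using tendsto_log_mul_log_one_sub.comp h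

theorem eq_of_hasDerivAt_zero_of_tendsto {f : ℝ → ℝ} {c : ℝ}
    (hf : ∀ x ∈ Ioo (0 : ℝ) 1, HasDerivAt f 0 x) (hc : Tendsto f (𝓝[>] 0) (𝓝 c)) {x : ℝ}
    (hx : x ∈ Ioo (0 : ℝ) 1) : f x = c := by
  refine tendsto_nhds_unique (tendsto_const_nhds.congr' ?_) hc
  filter_upwards [Ioo_mem_nhdsGT zero_lt_one] with y hy
  exact eq_of_hasDerivAt_zero_of_mem isOpen_Ioo isPreconnected_Ioo hf hx hy

theorem hasDerivAt_log_one_sub {x : ℝ} (hx : x < 1) :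
    HasDerivAt (fun t => Real.log (1 - t)) (-(1 - x)⁻¹) x := by
  simpa [Pi.neg_def] using (hasDerivAt_neg_log_one_sub hx).neg

/-- Euler's reflection formula. -/
theorem dilog_reflection {x : ℝ} (hx : x ∈ Ioo (0 : ℝ) 1) :
    dilog x + dilog (1 - x) = Real.pi ^ 2 / 6 - Real.log x * Real.log (1 - x) := by
  suffices dilog x + dilog (1 - x) + Real.log x * Real.log (1 - x) = Real.pi ^ 2 / 6 by linarith
  refine eq_of_hasDerivAt_zero_of_tendsto (f := fun x =>
    dilog x + dilog (1 - x) + Real.log x * Real.log (1 - x)) (fun y hy => ?_) ?_ hx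
  · have hy0 := hy.1.ne'
    have hy2 : 1 - y ≠ 0 := by linarith [hy.2]
    have h2 := (hasDerivAt_dilog (show 1 - y < 1 by linarith [hy.1])).comp y
      ((hasDerivAt_id y).const_sub 1)
    refine (((hasDerivAt_dilog hy.2).add h2).add
      ((Real.hasDerivAt_log hy0).mul (hasDerivAt_log_one_sub hy.2))).congr_deriv ?_
    rw [dilogKernel_of_ne hy0, dilogKernel_of_ne hy2]
    simp only [sub_sub_cancel]
    field_simp
    ring
  · have h1 : Tendsto (fun x : ℝ => 1 - x) (𝓝[>] 0) (𝓝[<] 1) := by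
      refine tendsto_nhdsWithin_iff.2 ⟨?_, ?_⟩
      · have : Continuous fun x : ℝ => 1 - x := by fun_prop
        simpa using (this.tendsto 0).mono_left nhdsWithin_le_nhds
      · filter_upwards [self_mem_nhdsWithin] with x (hx : 0 < x)
        simpa using hx
    have h0 := (continuousAt_dilog zero_lt_one).tendsto.mono_left
      (nhdsWithin_le_nhds (s := Ioi 0))
    rw [dilog_zero] at h0
    simpa using (h0.add (tendsto_dilog_one.comp h1)).add
      (tendsto_log_mul_log_one_sub.mono_left nhdsWithin_le_nhds)

theorem dilog_half : dilog (1 / 2) = Real.pi ^ 2 / 12 - Real.log 2 ^ 2 / 2 := by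
  have h := dilog_reflection (x := 1 / 2) (by norm_num)
  rw [show (1 : ℝ) - 1 / 2 = 1 / 2 by norm_num, show Real.log (1 / 2) = -Real.log 2 by simp] at h
  linarith

theorem dilog_neg_one : dilog (-1) = -(Real.pi ^ 2 / 12) := by
  have h := dilog_landen (x := -1) (by norm_num)
  have := dilog_half
  norm_num at h this
  linarith

/-- The duplication formula. -/
theorem dilog_sq {x : ℝ} (hx : x ∈ Ioo (-1 : ℝ) 1) :
    dilog (x ^ 2) = 2 * (dilog x + dilog (-x)) := by
  have key : ∀ y ∈ Ioo (-1 : ℝ) 1, HasDerivAt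
      (fun x => dilog (x ^ 2) - 2 * (dilog x + dilog (-x))) 0 y := by
    intro y hy
    have hy1 : 1 - y ≠ 0 := by linarith [hy.2]
    have hy2 : 1 + y ≠ 0 := by linarith [hy.1]
    have h1 := (hasDerivAt_dilog (x := y ^ 2) (by nlinarith [hy.1, hy.2])).comp y
      (hasDerivAt_pow 2 y)
    have h2 := (hasDerivAt_dilog (x := -y) (by linarith [hy.1])).comp y (hasDerivAt_neg y)
    refine (h1.sub (((hasDerivAt_dilog hy.2).add h2).const_mul 2)).congr_deriv ?_
    rcases eq_or_ne y 0 with rfl | h0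
    · simp
    · rw [dilogKernel_of_ne h0, dilogKernel_of_ne (neg_ne_zero.2 h0),
        dilogKernel_of_ne (pow_ne_zero 2 h0), show 1 - y ^ 2 = (1 - y) * (1 + y) by ring,
        Real.log_mul hy1 hy2, sub_neg_eq_add]
      field_simp
      ring
  have := eq_of_hasDerivAt_zero_of_mem isOpen_Ioo isPreconnected_Ioo key hx
    (show (0 : ℝ) ∈ Ioo (-1) 1 by simp)
  simp [dilog_zero] at this
  linarith

/-- The functional equation of the Legendre chi function `x ↦ (Li₂ x - Li₂ (-x)) / 2`. -/
theorem dilog_sub_dilog_neg {x : ℝ} (hx : x ∈ Ioo (0 : ℝ) 1) :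
    dilog ((1 - x) / (1 + x)) - dilog (-((1 - x) / (1 + x))) + (dilog x - dilog (-x)) =
      Real.pi ^ 2 / 4 + (Real.log x * Real.log (1 + x) - Real.log x * Real.log (1 - x)) := by
  suffices dilog ((1 - x) / (1 + x)) - dilog (-((1 - x) / (1 + x))) + (dilog x - dilog (-x))
      - (Real.log x * Real.log (1 + x) - Real.log x * Real.log (1 - x)) = Real.pi ^ 2 / 4 by
    linarith
  refine eq_of_hasDerivAt_zero_of_tendsto (f := fun x =>
    dilog ((1 - x) / (1 + x)) - dilog (-((1 - x) / (1 + x))) + (dilog x - dilog (-x))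
      - (Real.log x * Real.log (1 + x) - Real.log x * Real.log (1 - x))) (fun y hy => ?_) ?_ hx
  · have hy0 := hy.1
    have hy0' := hy0.ne'
    have hy1 : 0 < 1 - y := by linarith [hy.2]
    have hy2 : 0 < 1 + y := by linarith [hy.1]
    have hlt : (1 - y) / (1 + y) < 1 := by rw [div_lt_one hy2]; linarith
    have hpos : 0 < (1 - y) / (1 + y) := by positivity
    have hq : HasDerivAt (fun x : ℝ => (1 - x) / (1 + x)) (-2 / (1 + y) ^ 2) y := by
      refine (((hasDerivAt_id y).const_sub 1).div
        ((hasDerivAt_id y).const_add 1) hy2.ne').congr_deriv ?_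
      simp only [id]
      ring
    have h1 := (hasDerivAt_dilog hlt).comp y hq
    have h2 := (hasDerivAt_dilog (show -((1 - y) / (1 + y)) < 1 by linarith)).comp y hq.neg
    have h3 := (hasDerivAt_dilog (x := -y) (by linarith)).comp y (hasDerivAt_neg y)
    have hl := Real.hasDerivAt_log hy0'
    have hl' : HasDerivAt (fun x => Real.log (1 + x)) (1 / (1 + y)) y :=
      ((hasDerivAt_id y).const_add 1).log hy2.ne'
    refine (((h1.sub h2).add ((hasDerivAt_dilog hy.2).sub h3)).sub
      ((hl.mul hl').sub (hl.mul (hasDerivAt_log_one_sub hy.2)))).congr_deriv ?_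
    rw [dilogKernel_of_ne hy0', dilogKernel_of_ne (neg_ne_zero.2 hy0'),
      dilogKernel_of_ne hpos.ne', dilogKernel_of_ne (neg_ne_zero.2 hpos.ne'),
      show 1 - (1 - y) / (1 + y) = 2 * y / (1 + y) by field_simp; ring,
      show 1 - -((1 - y) / (1 + y)) = 2 / (1 + y) by field_simp; ring,
      Real.log_div (by positivity) hy2.ne', Real.log_div two_ne_zero hy2.ne',
      Real.log_mul two_ne_zero hy0', sub_neg_eq_add]
    field_simp
    ring
  · have hcont : ContinuousAt (fun x : ℝ => (1 - x) / (1 + x)) 0 :=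
      ContinuousAt.div (by fun_prop) (by fun_prop) (by norm_num)
    have hq : Tendsto (fun x : ℝ => (1 - x) / (1 + x)) (𝓝[>] 0) (𝓝[<] 1) := by
      refine tendsto_nhdsWithin_iff.2 ⟨?_, ?_⟩
      · simpa using hcont.tendsto.mono_left nhdsWithin_le_nhds
      · filter_upwards [self_mem_nhdsWithin] with x (hx : 0 < x)
        rw [mem_Iio, div_lt_one (by linarith)]
        linarith
    have hn : Tendsto (fun x : ℝ => -x) (𝓝 0) (𝓝 0) := by
      simpa using (continuous_neg.tendsto (0 : ℝ))
    have h0 := (continuousAt_dilog zero_lt_one).tendsto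
    rw [dilog_zero] at h0
    have hm := (continuousAt_dilog (show (-1 : ℝ) < 1 by norm_num)).tendsto.comp
      (hq.mono_right nhdsWithin_le_nhds).neg
    have h := ((tendsto_dilog_one.comp hq).sub hm).add
      ((h0.sub (h0.comp hn)).mono_left nhdsWithin_le_nhds) |>.sub
      ((tendsto_log_mul_log_one_add.sub tendsto_log_mul_log_one_sub).mono_left nhdsWithin_le_nhds)
    rw [dilog_neg_one] at h
    convert! h using 2
    ring

theorem dilog_value :
    dilog (2 / 3) + dilog (-8) / 3 - dilog (-2) = Real.pi ^ 2 / 6 - Real.log 3 ^ 2 / 2 := by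
  have l8 : Real.log 8 = 3 * Real.log 2 := by
    rw [show (8 : ℝ) = 2 ^ 3 by norm_num, Real.log_pow]; norm_num
  have l9 : Real.log 9 = 2 * Real.log 3 := by
    rw [show (9 : ℝ) = 3 ^ 2 by norm_num, Real.log_pow]; norm_num
  have l32 : Real.log (3 / 2) = Real.log 3 - Real.log 2 := Real.log_div (by simp) (by simp)
  have l23 : Real.log (2 / 3) = Real.log 2 - Real.log 3 := Real.log_div (by simp) (by simp)
  have l89 : Real.log (8 / 9) = 3 * Real.log 2 - 2 * Real.log 3 := by
    rw [Real.log_div (by simp) (by simp), l8, l9]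
  have l13 : Real.log (1 / 3) = -Real.log 3 := by simp
  have l19 : Real.log (1 / 9) = -(2 * Real.log 3) := by simp [l9]
  have l12 : Real.log (1 / 2) = -Real.log 2 := by simp
  have e1 := dilog_landen (x := -8) (by norm_num)
  have e2 := dilog_landen (x := -2) (by norm_num)
  have e3 := dilog_landen (x := -(1 / 2)) (by norm_num)
  have e4 := dilog_reflection (x := 1 / 3) (by norm_num)
  have e5 := dilog_reflection (x := 1 / 9) (by norm_num)
  have e6 := dilog_sq (x := 1 / 3) (by norm_num)
  have e7 := dilog_sub_dilog_neg (x := 1 / 2) (by norm_num)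
  have e8 := dilog_half
  rw [show (-8 : ℝ) / (-8 - 1) = 8 / 9 by norm_num, show (1 : ℝ) - -8 = 9 by norm_num, l9] at e1
  rw [show (-2 : ℝ) / (-2 - 1) = 2 / 3 by norm_num, show (1 : ℝ) - -2 = 3 by norm_num] at e2
  rw [show -(1 / 2 : ℝ) / (-(1 / 2) - 1) = 1 / 3 by norm_num,
    show (1 : ℝ) - -(1 / 2) = 3 / 2 by norm_num, l32] at e3
  rw [show (1 : ℝ) - 1 / 3 = 2 / 3 by norm_num, l13, l23] at e4
  rw [show (1 : ℝ) - 1 / 9 = 8 / 9 by norm_num, l19, l89] at e5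
  rw [show (1 / 3 : ℝ) ^ 2 = 1 / 9 by norm_num] at e6
  rw [show (1 - 1 / 2 : ℝ) / (1 + 1 / 2) = 1 / 3 by norm_num,
    show (1 : ℝ) + 1 / 2 = 3 / 2 by norm_num, show (1 : ℝ) - 1 / 2 = 1 / 2 by norm_num,
    l12, l32] at e7
  linarith

theorem integral_pow_mul_one_sub_pow (a b : ℕ) :
    ∫ t in (0 : ℝ)..1, t ^ a * (1 - t) ^ b =
      (a.factorial * b.factorial : ℝ) / (a + b + 1).factorial := by
  induction b generalizing a with
  | zero =>
    simp [integral_pow, Nat.factorial_succ]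
    field_simp
  | succ b ih =>
    have hd : ∀ t : ℝ, HasDerivAt (fun t : ℝ => t ^ (a + 1) * (1 - t) ^ (b + 1))
        ((a + 1) * (t ^ a * (1 - t) ^ (b + 1)) - (b + 1) * (t ^ (a + 1) * (1 - t) ^ b)) t := by
      intro t
      refine ((hasDerivAt_pow (a + 1) t).mul
        (((hasDerivAt_id t).const_sub 1).pow (b + 1))).congr_deriv ?_
      simp
      ring
    have h := intervalIntegral.integral_eq_sub_of_hasDerivAt (a := 0) (b := 1)
      (fun t _ => hd t) (Continuous.intervalIntegrable (by fun_prop) _ _)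
    rw [intervalIntegral.integral_sub (Continuous.intervalIntegrable (by fun_prop) _ _)
      (Continuous.intervalIntegrable (by fun_prop) _ _), intervalIntegral.integral_const_mul,
      intervalIntegral.integral_const_mul, ih (a + 1)] at h
    have ha : (a + 1 : ℝ) ≠ 0 := by positivity
    simp at h
    rw [show a + (b + 1) + 1 = a + 1 + b + 1 by ring]
    rw [sub_eq_zero, mul_comm, ← eq_div_iff ha] at h
    rw [h, Nat.factorial_succ a, Nat.factorial_succ b]
    push_cast
    field_simp

theorem integral_beta_choose (n : ℕ) :
    ∫ t in (0 : ℝ)..1, t ^ n * (1 - t) ^ (2 * (n + 1)) =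
      1 / ((n + 1) * Nat.choose (3 * (n + 1)) (n + 1)) := by
  rw [integral_pow_mul_one_sub_pow, Nat.cast_choose ℝ (by lia),
    show 3 * (n + 1) - (n + 1) = 2 * (n + 1) by lia,
    show n + 2 * (n + 1) + 1 = 3 * (n + 1) by lia, Nat.factorial_succ n]
  push_cast
  field_simp

theorem stmt_12 :
    ∑' n : ℕ,
        (8 : ℝ) ^ (n + 1) /
          ((n + 1) ^ 2 * 3 ^ (n + 1) * (Nat.choose (3 * (n + 1)) (n + 1))) =
      Real.pi ^ 2 / 6 - Real.log 3 ^ 2 / 2 := by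
  let F : ℝ → ℝ := fun t =>
    2 / 3 * dilogKernel (2 / 3 * t) - 8 * t ^ 2 * dilogKernel (-8 * t ^ 3)
      + 2 * dilogKernel (-2 * t)
  have hmem : ∀ t ∈ Icc (0 : ℝ) 1, 2 / 3 * t < 1 ∧ -8 * t ^ 3 < 1 ∧ -2 * t < 1 := by
    intro t ht
    have := pow_nonneg ht.1 3
    exact ⟨by linarith [ht.2], by linarith, by linarith [ht.1]⟩
  have hint : ∫ t in (0 : ℝ)..1, F t = Real.pi ^ 2 / 6 - Real.log 3 ^ 2 / 2 := by
    have hderiv : ∀ t ∈ uIcc (0 : ℝ) 1, HasDerivAt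
        (fun t => dilog (2 / 3 * t) + dilog (-8 * t ^ 3) / 3 - dilog (-2 * t)) (F t) t := by
      intro t ht
      rw [uIcc_of_le zero_le_one] at ht
      obtain ⟨h1, h2, h3⟩ := hmem t ht
      have d1 := (hasDerivAt_dilog h1).comp t ((hasDerivAt_id t).const_mul (2 / 3))
      have d2 := (hasDerivAt_dilog h2).comp t ((hasDerivAt_pow 3 t).const_mul (-8))
      have d3 := (hasDerivAt_dilog h3).comp t ((hasDerivAt_id t).const_mul (-2))
      refine ((d1.add (d2.div_const 3)).sub d3).congr_deriv ?_
      simp [F]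
      ring
    have hcont : ContinuousOn F (uIcc 0 1) := by
      rw [uIcc_of_le zero_le_one]
      have c1 : ContinuousOn (fun t : ℝ => dilogKernel (2 / 3 * t)) (Icc 0 1) :=
        continuousOn_dilogKernel.comp (by fun_prop) fun t ht => (hmem t ht).1
      have c2 : ContinuousOn (fun t : ℝ => dilogKernel (-8 * t ^ 3)) (Icc 0 1) :=
        continuousOn_dilogKernel.comp (by fun_prop) fun t ht => (hmem t ht).2.1
      have c3 : ContinuousOn (fun t : ℝ => dilogKernel (-2 * t)) (Icc 0 1) :=
        continuousOn_dilogKernel.comp (by fun_prop) fun t ht => (hmem t ht).2.2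
      fun_prop
    rw [intervalIntegral.integral_eq_sub_of_hasDerivAt hderiv hcont.intervalIntegrable]
    simp only [mul_one, one_pow, mul_zero, ne_eq, OfNat.ofNat_ne_zero, not_false_eq_true,
      zero_pow, dilog_zero]
    linarith [dilog_value]
  have hF : ∀ t : ℝ, 0 < t → t ≤ 1 →
      F t = -Real.log (1 - 8 / 3 * (t * (1 - t) ^ 2)) / t := by
    intro t ht ht1
    have hq : 0 < 1 - 2 * t + 4 * t ^ 2 := by nlinarith [sq_nonneg (1 - t)]
    have hp : 0 < 1 + 2 * t := by linarith
    have hl : 0 < 1 - 2 / 3 * t := by linarith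
    simp only [F]
    rw [dilogKernel_of_ne (by positivity), dilogKernel_of_ne (by simp [ht.ne']),
      dilogKernel_of_ne (by simp [ht.ne']),
      show 1 - 8 / 3 * (t * (1 - t) ^ 2) = (1 - 2 / 3 * t) * (1 - 2 * t + 4 * t ^ 2) by ring,
      show 1 - -8 * t ^ 3 = (1 + 2 * t) * (1 - 2 * t + 4 * t ^ 2) by ring,
      show 1 - -2 * t = 1 + 2 * t by ring,
      Real.log_mul hp.ne' hq.ne', Real.log_mul hl.ne' hq.ne']
    field_simp
    ring
  have hbound : ∀ t ∈ Ioc (0 : ℝ) 1, t * (1 - t) ^ 2 ≤ 4 / 27 := by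
    intro t ht
    nlinarith [mul_nonneg (sq_nonneg (3 * t - 1)) (show 0 ≤ 4 - 3 * t by linarith [ht.2])]
  have hsum : HasSum (fun n : ℕ => ∫ t in (0 : ℝ)..1,
      (8 / 3) ^ (n + 1) / (n + 1 : ℝ) * (t ^ n * (1 - t) ^ (2 * (n + 1))))
      (∫ t in (0 : ℝ)..1, F t) := by
    refine intervalIntegral.hasSum_integral_of_dominated_convergence
      (fun n _ => 8 / 3 * (32 / 81) ^ n) (fun n => by fun_prop) (fun n => ?_) ?_ (by simp) ?_
    · refine Eventually.of_forall fun t ht => ?_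
      rw [uIoc_of_le zero_le_one] at ht
      have h0 := ht.1.le
      have h1 : 0 ≤ 1 - t := by linarith [ht.2]
      have h2 : (1 - t) ^ 2 ≤ 1 := pow_le_one₀ h1 (by linarith)
      rw [Real.norm_of_nonneg (by positivity)]
      calc (8 / 3 : ℝ) ^ (n + 1) / (n + 1 : ℝ) * (t ^ n * (1 - t) ^ (2 * (n + 1)))
          ≤ (8 / 3 : ℝ) ^ (n + 1) * (t ^ n * (1 - t) ^ (2 * (n + 1))) := by
            gcongr
            exact div_le_self (by positivity) (by linarith [n.cast_nonneg (α := ℝ)])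
        _ = 8 / 3 * (8 / 3 * (t * (1 - t) ^ 2)) ^ n * (1 - t) ^ 2 := by
            rw [mul_pow, mul_pow, ← pow_mul]
            ring
        _ ≤ 8 / 3 * (32 / 81) ^ n * 1 := by
            gcongr
            linarith [hbound t ht]
        _ = _ := mul_one _
    · exact Eventually.of_forall fun t _ =>
        (summable_geometric_of_lt_one (by norm_num) (by norm_num)).mul_left _
    · refine Eventually.of_forall fun t ht => ?_
      rw [uIoc_of_le zero_le_one] at ht
      have h0 := ht.1
      have hx0 : 0 ≤ 8 / 3 * (t * (1 - t) ^ 2) := by positivity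
      rw [hF t ht.1 ht.2]
      have hx1 : |8 / 3 * (t * (1 - t) ^ 2)| < 1 := by
        rw [abs_of_nonneg hx0]
        linarith [hbound t ht]
      convert! (Real.hasSum_pow_div_log_of_abs_lt_one hx1).div_const t using 2 with n
      rw [mul_pow, mul_pow, ← pow_mul]
      field_simp
      ring
  rw [hint] at hsum
  rw [← hsum.tsum_eq]
  refine tsum_congr fun n => ?_
  rw [intervalIntegral.integral_const_mul, integral_beta_choose, div_pow]
  field_simp
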